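/- For every bound B ∈ N there exists a compact embedded 1-manifold (curve) C in R^2 with rectified linear complexity greater than B; hence for any ReLU DNN architecture with input dimension 2 and output dimension 1, there exists an embedded curve that admits no encoding map realized by that architecture. -/

import Mathlib

/-- Coordinatewise ReLU. -/
def relu {n : ℕ} (x : Fin n → ℝ) : Fin n → ℝ := fun i => max 0 (x i)

/-- The hidden-layer part of a ReLU DNN with widths `w 0, w 1, …` and affine layer maps
`T i : ℝ^{w i} → ℝ^{w (i+1)}`:  `hiddenEval w T j = σ ∘ T (j-1) ∘ ⋯ ∘ σ ∘ T 0`. -/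
def hiddenEval (w : ℕ → ℕ) (T : ∀ i : ℕ, (Fin (w i) → ℝ) →ᵃ[ℝ] (Fin (w (i + 1)) → ℝ)) :
    (j : ℕ) → (Fin (w 0) → ℝ) → (Fin (w j) → ℝ)
  | 0 => id
  | j + 1 => fun x => relu (T j (hiddenEval w T j x))

/-- `M ⊆ ℝ^n` is an embedded `m`-dimensional (topological) manifold. -/
def IsEmbeddedManifold (m : ℕ) {n : ℕ} (M : Set (Fin n → ℝ)) : Prop :=
  ∀ x ∈ M, ∃ U : Set (Fin n → ℝ), IsOpen U ∧ x ∈ U ∧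
    ∃ V : Set (Fin m → ℝ), IsOpen V ∧ Nonempty ((U ∩ M : Set (Fin n → ℝ)) ≃ₜ V)

/-- A linear rectifiable atlas of `M ⊆ ℝ^n` with `k` charts. -/
def LinRectAtlas {n : ℕ} (m : ℕ) (M : Set (Fin n → ℝ)) (k : ℕ) : Prop :=
  ∃ (U : Fin k → Set (Fin n → ℝ)) (A : Fin k → ((Fin n → ℝ) →ᵃ[ℝ] (Fin m → ℝ))),
    (M ⊆ ⋃ i, U i) ∧
    ∀ i, Topology.IsEmbedding (fun x : (U i ∩ M : Set (Fin n → ℝ)) => A i (x : Fin n → ℝ))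

open MeasureTheory Set

/-- The planar point with polar coordinates `r, t`. -/
noncomputable def polarPt (r t : ℝ) : Fin 2 → ℝ := ![r * Real.cos t, r * Real.sin t]

/-- Union of circles with squared radii in `S`. -/
def circlesOf (S : Set ℝ) : Set (Fin 2 → ℝ) := {x | x 0 ^ 2 + x 1 ^ 2 ∈ S}

/-- Cross product with `p`, as a linear map. -/
noncomputable def crossMap (p : Fin 2 → ℝ) : (Fin 2 → ℝ) →ₗ[ℝ] (Fin 1 → ℝ) :=
  LinearMap.pi fun _ => p 0 • LinearMap.proj 1 - p 1 • LinearMap.proj 0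

lemma crossMap_apply (p x : Fin 2 → ℝ) (i : Fin 1) :
    crossMap p x i = p 0 * x 1 - p 1 * x 0 := by
  simp [crossMap]

lemma circles_compact {S : Set ℝ} (hS : S.Finite) : IsCompact (circlesOf S) := by
  obtain ⟨M, hM⟩ := hS.bddAbove
  have hc : IsClosed (circlesOf S) :=
    hS.isClosed.preimage (by fun_prop : Continuous fun x : Fin 2 → ℝ => x 0 ^ 2 + x 1 ^ 2)
  refine Metric.isCompact_of_isClosed_isBounded hc ?_
  refine (Metric.isBounded_closedBall (x := (0 : Fin 2 → ℝ)) (r := |M| + 1)).subset ?_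
  intro x hx
  have h : x 0 ^ 2 + x 1 ^ 2 ≤ M := hM hx
  have hM' := le_abs_self M
  have h0 := abs_nonneg M
  rw [mem_closedBall_zero_iff, pi_norm_le_iff_of_nonneg (by positivity)]
  intro i
  rw [Real.norm_eq_abs]
  refine abs_le_of_sq_le_sq (b := |M| + 1) ?_ (by positivity)
  fin_cases i <;> simp <;> nlinarith [sq_nonneg (x 0), sq_nonneg (x 1)]

lemma circles_chart {S : Set ℝ} (hS : S.Finite) (hpos : ∀ s ∈ S, 0 < s) (p : Fin 2 → ℝ)
    (hp : p ∈ circlesOf S) : ∃ U : Set (Fin 2 → ℝ), IsOpen U ∧ p ∈ U ∧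
    Topology.IsEmbedding (fun x : (U ∩ circlesOf S : Set (Fin 2 → ℝ)) =>
      crossMap p (x : Fin 2 → ℝ)) ∧
    IsOpen (range (fun x : (U ∩ circlesOf S : Set (Fin 2 → ℝ)) =>
      crossMap p (x : Fin 2 → ℝ))) := by
  set R : ℝ := p 0 ^ 2 + p 1 ^ 2 with hR
  have hRS : R ∈ S := hp
  have hR0 : 0 < R := hpos _ hRS
  let U : Set (Fin 2 → ℝ) := {x | 0 < x 0 * p 0 + x 1 * p 1} ∩
    (fun x : Fin 2 → ℝ => x 0 ^ 2 + x 1 ^ 2) ⁻¹' (S \ {R})ᶜ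
  have hUC : ∀ x, x ∈ U ∩ circlesOf S ↔
      0 < x 0 * p 0 + x 1 * p 1 ∧ x 0 ^ 2 + x 1 ^ 2 = R := by
    intro x
    simp only [U, circlesOf, mem_inter_iff, mem_ofPred_eq, mem_preimage, mem_compl_iff, mem_sdiff,
      mem_singleton_iff]
    constructor
    · rintro ⟨⟨h1, h2⟩, h3⟩
      exact ⟨h1, by by_contra h; exact h2 ⟨h3, h⟩⟩
    · rintro ⟨h1, h2⟩
      exact ⟨⟨h1, fun h => h.2 h2⟩, h2 ▸ hRS⟩
  let g : (Fin 1 → ℝ) → (Fin 2 → ℝ) := fun s =>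
    ![(Real.sqrt (R ^ 2 - s 0 ^ 2) * p 0 - s 0 * p 1) / R,
      (Real.sqrt (R ^ 2 - s 0 ^ 2) * p 1 + s 0 * p 0) / R]
  have hg : Continuous g := by
    refine continuous_pi fun i => ?_
    fin_cases i <;> simp [g] <;> fun_prop
  have hcont : Continuous (fun x : (U ∩ circlesOf S : Set (Fin 2 → ℝ)) =>
      crossMap p (x : Fin 2 → ℝ)) :=
    (LinearMap.continuous_of_finiteDimensional (crossMap p)).comp continuous_subtype_val
  refine ⟨U, ?_, ?_, ?_, ?_⟩
  · refine IsOpen.inter (isOpen_lt continuous_const (by fun_prop)) ?_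
    exact ((hS.subset sdiff_subset).isClosed.isOpen_compl).preimage (by fun_prop)
  · refine ((hUC p).2 ⟨?_, rfl⟩).1
    nlinarith
  · refine Topology.IsEmbedding.of_comp hcont hg ?_
    have : (g ∘ fun x : (U ∩ circlesOf S : Set (Fin 2 → ℝ)) => crossMap p (x : Fin 2 → ℝ))
        = Subtype.val := by
      funext x
      obtain ⟨h1, h2⟩ := (hUC x.1).1 x.2
      have hs : Real.sqrt (R ^ 2 - (p 0 * x.1 1 - p 1 * x.1 0) ^ 2)
          = x.1 0 * p 0 + x.1 1 * p 1 := by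
        rw [show R ^ 2 - (p 0 * x.1 1 - p 1 * x.1 0) ^ 2 = (x.1 0 * p 0 + x.1 1 * p 1) ^ 2 by
          have : R ^ 2 = R * (x.1 0 ^ 2 + x.1 1 ^ 2) := by rw [h2]; ring
          rw [this, hR]; ring]
        exact Real.sqrt_sq h1.le
      funext i
      fin_cases i
      · simp only [g, Function.comp, crossMap_apply, hs]
        simp
        rw [div_eq_iff hR0.ne', hR]; ring
      · simp only [g, Function.comp, crossMap_apply, hs]
        simp
        rw [div_eq_iff hR0.ne', hR]; ring
    rw [this]
    exact Topology.IsEmbedding.subtypeVal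
  · have : range (fun x : (U ∩ circlesOf S : Set (Fin 2 → ℝ)) => crossMap p (x : Fin 2 → ℝ))
        = {s : Fin 1 → ℝ | s 0 ^ 2 < R ^ 2} := by
      ext s
      simp only [mem_range, mem_ofPred_eq]
      constructor
      · rintro ⟨x, rfl⟩
        obtain ⟨h1, h2⟩ := (hUC x.1).1 x.2
        rw [crossMap_apply]
        have h3 : R ^ 2 = R * (x.1 0 ^ 2 + x.1 1 ^ 2) := by rw [h2]; ring
        have h4 : R ^ 2 - (p 0 * x.1 1 - p 1 * x.1 0) ^ 2 = (x.1 0 * p 0 + x.1 1 * p 1) ^ 2 := by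
          rw [h3, hR]; ring
        have := pow_pos h1 2
        linarith
      · intro hs
        have hq : 0 < Real.sqrt (R ^ 2 - s 0 ^ 2) := Real.sqrt_pos.2 (by linarith)
        have hq2 : Real.sqrt (R ^ 2 - s 0 ^ 2) ^ 2 = R ^ 2 - s 0 ^ 2 :=
          Real.sq_sqrt (by linarith)
        refine ⟨⟨g s, (hUC _).2 ⟨?_, ?_⟩⟩, ?_⟩
        · have : g s 0 * p 0 + g s 1 * p 1 = Real.sqrt (R ^ 2 - s 0 ^ 2) := by
            simp only [g, Matrix.cons_val_zero, Matrix.cons_val_one]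
            field_simp
            rw [hR]; ring
          rw [this]; exact hq
        · simp only [g, Matrix.cons_val_zero, Matrix.cons_val_one]
          generalize Real.sqrt (R ^ 2 - s 0 ^ 2) = q at *
          have : ((q * p 0 - s 0 * p 1) / R) ^ 2 + ((q * p 1 + s 0 * p 0) / R) ^ 2
              = (q ^ 2 + s 0 ^ 2) * (p 0 ^ 2 + p 1 ^ 2) / R ^ 2 := by
            field_simp; ring
          rw [this, hq2, ← hR]
          field_simp
          ring
        · funext i
          have hi : i = 0 := Subsingleton.elim _ _
          subst hi
          rw [crossMap_apply]
          simp only [g, Matrix.cons_val_zero, Matrix.cons_val_one]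
          field_simp
          rw [hR]; ring
    rw [this]
    exact isOpen_lt (by fun_prop) continuous_const

lemma circles_manifold {S : Set ℝ} (hS : S.Finite) (hpos : ∀ s ∈ S, 0 < s) :
    IsEmbeddedManifold 1 (circlesOf S) := by
  intro p hp
  obtain ⟨U, hU, hpU, he, ho⟩ := circles_chart hS hpos p hp
  exact ⟨U, hU, hpU, _, ho, ⟨he.toHomeomorph⟩⟩

lemma circles_atlas {S : Set ℝ} (hS : S.Finite) (hpos : ∀ s ∈ S, 0 < s) :
    ∃ k, LinRectAtlas 1 (circlesOf S) k := by
  choose! U hU hpU he ho using circles_chart hS hpos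
  obtain ⟨t, ht, hcov⟩ := (circles_compact hS).elim_nhds_subcover U
    (fun x hx => (hU x hx).mem_nhds (hpU x hx))
  refine ⟨t.card, fun i => U (t.equivFin.symm i), fun i =>
    (crossMap (t.equivFin.symm i : Fin 2 → ℝ)).toAffineMap, ?_, ?_⟩
  · intro x hx
    obtain ⟨y, hy, hxy⟩ := mem_iUnion₂.1 (hcov hx)
    exact mem_iUnion.2 ⟨t.equivFin ⟨y, hy⟩, by simpa using hxy⟩
  · intro i
    exact he _ (ht _ (t.equivFin.symm i).2)

lemma chart_borel {X Y : Type*} [MetricSpace X] [MeasurableSpace X] [BorelSpace X] [MetricSpace Y]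
    (f : X → Y) (hf : Continuous f) (D : Set X)
    (h : Topology.IsEmbedding (fun x : D => f x)) :
    ∃ D', D ⊆ D' ∧ MeasurableSet D' ∧ InjOn f D' := by
  refine ⟨closure D ∩ ⋂ m : ℕ, ⋃ l : ℕ, ⋂ y ∈ D,
    {x | 1 / ((l : ℝ) + 1) ≤ dist (f y) (f x) ∨ dist y x ≤ 1 / ((m : ℝ) + 1)}, ?_, ?_, ?_⟩
  · intro x hx
    refine ⟨subset_closure hx, mem_iInter.2 fun m => ?_⟩
    have hb : Metric.ball (⟨x, hx⟩ : D) (1 / ((m : ℝ) + 1)) ∈ nhds (⟨x, hx⟩ : D) :=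
      Metric.ball_mem_nhds _ (by positivity)
    rw [h.isInducing.nhds_eq_comap] at hb
    obtain ⟨t, ht, hts⟩ := hb
    obtain ⟨ε, hε, hεt⟩ := Metric.mem_nhds_iff.1 ht
    obtain ⟨l, hl⟩ := exists_nat_one_div_lt hε
    refine mem_iUnion.2 ⟨l, mem_iInter₂.2 fun y hy => ?_⟩
    by_cases hd : 1 / ((l : ℝ) + 1) ≤ dist (f y) (f x)
    · exact Or.inl hd
    · right
      have : (⟨y, hy⟩ : D) ∈ Metric.ball (⟨x, hx⟩ : D) (1 / ((m : ℝ) + 1)) := by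
        apply hts
        apply hεt
        simp only [Metric.mem_ball]
        linarith
      exact (Metric.mem_ball.1 this).le
  · refine isClosed_closure.measurableSet.inter (MeasurableSet.iInter fun m =>
      MeasurableSet.iUnion fun l => IsClosed.measurableSet ?_)
    refine isClosed_biInter fun y _ => ?_
    have h1 : IsClosed {x | 1 / ((l : ℝ) + 1) ≤ dist (f y) (f x)} :=
      isClosed_le continuous_const (continuous_const.dist hf)
    have h2 : IsClosed {x | dist y x ≤ 1 / ((m : ℝ) + 1)} :=
      isClosed_le (continuous_const.dist continuous_id) continuous_const
    exact h1.union h2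
  · rintro x ⟨hx, hx2⟩ x' ⟨hx', -⟩ hxx
    refine dist_le_zero.1 (le_of_forall_pos_le_add fun ε hε => ?_)
    obtain ⟨m, hm⟩ := exists_nat_one_div_lt (half_pos hε)
    obtain ⟨l, hl⟩ := mem_iUnion.1 (mem_iInter.1 hx2 m)
    have hn : Metric.ball x' (ε / 2) ∩ f ⁻¹' Metric.ball (f x') (1 / ((l : ℝ) + 1)) ∈ nhds x' :=
      Filter.inter_mem (Metric.ball_mem_nhds _ (half_pos hε))
        (hf.continuousAt.preimage_mem_nhds (Metric.ball_mem_nhds _ (by positivity)))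
    obtain ⟨y, ⟨hy1, hy2⟩, hyD⟩ := mem_closure_iff_nhds.1 hx' _ hn
    have := mem_iInter₂.1 hl y hyD
    simp only [mem_ofPred_eq, hxx] at this
    have hy2' : dist (f y) (f x') < 1 / ((l : ℝ) + 1) := hy2
    rcases this with h3 | h3
    · linarith
    · have := dist_triangle x y x'
      rw [dist_comm x y] at this
      have : dist y x' < ε / 2 := hy1
      linarith

lemma affine_coord (A : (Fin 2 → ℝ) →ᵃ[ℝ] (Fin 1 → ℝ)) :
    ∃ a b c : ℝ, ∀ x, A x 0 = a * x 0 + b * x 1 + c := by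
  refine ⟨A.linear (Pi.single 0 1) 0, A.linear (Pi.single 1 1) 0, A 0 0, fun x => ?_⟩
  have h1 : A x = A.linear x + A 0 := congrFun (AffineMap.decomp A) x
  have h2 : x = x 0 • (Pi.single 0 1 : Fin 2 → ℝ) + x 1 • (Pi.single 1 1 : Fin 2 → ℝ) := by
    funext i; fin_cases i <;> simp
  rw [h1]
  conv_lhs => rw [h2]
  simp only [map_add, map_smul, Pi.add_apply, Pi.smul_apply, smul_eq_mul]
  ring

/-- angles in `[0,1]` where the direction functional is small -/
def badSet (a b ε : ℝ) : Set ℝ :=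
  {t | t ∈ Icc (0 : ℝ) 1 ∧ |b * Real.cos t - a * Real.sin t| < ε * (|a| + |b|)}

lemma badSet_meas (a b ε : ℝ) : MeasurableSet (badSet a b ε) := by
  have h1 : IsOpen {t : ℝ | |b * Real.cos t - a * Real.sin t| < ε * (|a| + |b|)} :=
    isOpen_lt (by fun_prop) continuous_const
  exact (measurableSet_Icc (a := (0 : ℝ)) (b := 1)).inter h1.measurableSet

lemma sin_ge_half {d : ℝ} (h0 : 0 ≤ d) (h1 : d ≤ 1) : d / 2 ≤ Real.sin d := by
  rcases h0.eq_or_lt with rfl | h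
  · simp
  · have := Real.sin_gt_sub_cube h
    nlinarith [mul_pos h h]

lemma badSet_vol (a b ε : ℝ) (hε : 0 ≤ ε) : volume (badSet a b ε) ≤ ENNReal.ofReal (8 * ε) := by
  refine (Real.volume_le_diam _).trans (Metric.ediam_le ?_)
  have key : ∀ s ∈ badSet a b ε, ∀ t ∈ badSet a b ε, s ≤ t → t - s ≤ 8 * ε := by
    intro s hs t ht hst
    obtain ⟨⟨hs0, hs1⟩, hs⟩ := hs
    obtain ⟨⟨ht0, ht1⟩, ht⟩ := ht
    have hρ : 0 < |a| + |b| := by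
      by_contra h
      have h0 : |a| + |b| = 0 := le_antisymm (not_lt.1 h) (by positivity)
      rw [h0, mul_zero] at hs
      exact absurd hs (not_lt.2 (abs_nonneg _))
    set u := b * Real.cos s - a * Real.sin s
    set v := b * Real.cos t - a * Real.sin t
    have e1 : b * Real.sin (t - s) = u * Real.sin t - v * Real.sin s := by
      simp only [u, v, Real.sin_sub]; ring
    have e2 : a * Real.sin (t - s) = u * Real.cos t - v * Real.cos s := by
      simp only [u, v, Real.sin_sub]; ring
    have hS := sin_ge_half (sub_nonneg.2 hst) (by linarith : t - s ≤ 1)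
    have hS0 : 0 ≤ Real.sin (t - s) := le_trans (by linarith) hS
    have bd : ∀ p q : ℝ, |p| ≤ 1 → |q| ≤ 1 → |u * p - v * q| ≤ 2 * (ε * (|a| + |b|)) := by
      intro p q hp hq
      calc |u * p - v * q| ≤ |u * p| + |v * q| := abs_sub _ _
        _ = |u| * |p| + |v| * |q| := by rw [abs_mul, abs_mul]
        _ ≤ |u| * 1 + |v| * 1 := by gcongr
        _ ≤ _ := by linarith
    have b1 := bd _ _ (Real.abs_sin_le_one t) (Real.abs_sin_le_one s)
    have b2 := bd _ _ (Real.abs_cos_le_one t) (Real.abs_cos_le_one s)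
    rw [← e1, abs_mul, abs_of_nonneg hS0] at b1
    rw [← e2, abs_mul, abs_of_nonneg hS0] at b2
    have : (|a| + |b|) * Real.sin (t - s) ≤ (|a| + |b|) * (4 * ε) := by linarith
    have := le_of_mul_le_mul_left this hρ
    linarith
  intro s hs t ht
  rw [edist_dist]
  apply ENNReal.ofReal_le_ofReal
  rw [Real.dist_eq]
  rcases le_total s t with h | h
  · rw [abs_sub_comm, abs_of_nonneg (by linarith)]; exact key s hs t ht h
  · rw [abs_of_nonneg (by linarith)]; exact key t ht s hs h

lemma polarPt_sq (r t : ℝ) : polarPt r t 0 ^ 2 + polarPt r t 1 ^ 2 = r ^ 2 := by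
  simp only [polarPt, Matrix.cons_val_zero, Matrix.cons_val_one]
  nlinarith [Real.sin_sq_add_cos_sq t]

lemma polarPt_continuous (r : ℝ) : Continuous (polarPt r) := by
  refine continuous_pi fun i => ?_
  fin_cases i <;> simp [polarPt] <;> fun_prop

lemma polarPt_inj {r s t u : ℝ} (hr : 0 < r) (hs : 0 < s) (ht : t ∈ Icc (0 : ℝ) 1)
    (hu : u ∈ Icc (0 : ℝ) 1) (h : polarPt r t = polarPt s u) : r = s ∧ t = u := by
  have h1 : r ^ 2 = s ^ 2 := by rw [← polarPt_sq r t, h, polarPt_sq]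
  have h2 : r = s := by nlinarith
  subst h2
  refine ⟨rfl, ?_⟩
  have h3 : r * Real.cos t = r * Real.cos u := by simpa [polarPt] using congrFun h 0
  have h4 := mul_left_cancel₀ hr.ne' h3
  have := Real.pi_gt_three
  exact Real.injOn_cos ⟨ht.1, by linarith [ht.2]⟩ ⟨hu.1, by linarith [hu.2]⟩ h4

/-- The total angular measure covered by one chart outside its bad angles. -/
lemma chart_bound {n : ℕ} (r : Fin n → ℝ) (hr : Function.Injective r) (hr1 : ∀ j, 1 ≤ r j)
    (hr2 : ∀ j, r j ≤ 2) (a b c ε : ℝ) (hε : 0 < ε) (D : Set (Fin 2 → ℝ)) (hD : MeasurableSet D)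
    (hinj : InjOn (fun x : Fin 2 → ℝ => a * x 0 + b * x 1 + c) D) (G : Set ℝ)
    (hG : MeasurableSet G) (hG1 : G ⊆ Icc 0 1) (hGb : Disjoint G (badSet a b ε)) :
    ∑ j, volume (polarPt (r j) ⁻¹' D ∩ G) ≤ ENNReal.ofReal (4 / ε) := by
  set f : (Fin 2 → ℝ) → ℝ := fun x => a * x 0 + b * x 1 + c with hf
  set E : Fin n → Set ℝ := fun j => polarPt (r j) ⁻¹' D ∩ G with hE
  have hEm : ∀ j, MeasurableSet (E j) := fun j =>
    ((polarPt_continuous (r j)).measurable hD).inter hG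
  have hr0 : ∀ j, 0 < r j := fun j => by linarith [hr1 j]
  have hcr : ∀ j k, ∀ t ∈ E j, ∀ u ∈ E k,
      f (polarPt (r j) t) = f (polarPt (r k) u) → j = k ∧ t = u := by
    intro j k t ht u hu h
    have := polarPt_inj (hr0 j) (hr0 k) (hG1 ht.2) (hG1 hu.2) (hinj ht.1 hu.1 h)
    exact ⟨hr this.1, this.2⟩
  rcases (by positivity : 0 ≤ |a| + |b|).eq_or_lt with h0 | hρ
  · have ha : a = 0 := by
      have := abs_nonneg a; have := abs_nonneg b
      exact abs_eq_zero.1 (by linarith)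
    have hb : b = 0 := by
      have := abs_nonneg a; have := abs_nonneg b
      exact abs_eq_zero.1 (by linarith)
    have hz : ∀ j, volume (E j) = 0 := by
      intro j
      apply Set.Subsingleton.measure_zero
      intro t ht u hu
      exact (hcr j j t ht u hu (by simp [hf, ha, hb])).2
    change ∑ j, volume (E j) ≤ _
    simp [hz]
  · have hfc : ∀ j, Continuous fun t => f (polarPt (r j) t) := fun j =>
      (by fun_prop : Continuous f).comp (polarPt_continuous (r j))
    have hEi : ∀ j, InjOn (fun t => f (polarPt (r j) t)) (E j) := fun j t ht u hu h =>
      (hcr j j t ht u hu h).2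
    have himm : ∀ j, MeasurableSet ((fun t => f (polarPt (r j) t)) '' E j) := fun j =>
      (hEm j).image_of_continuousOn_injOn (hfc j).continuousOn (hEi j)
    have hlow : ∀ j, ENNReal.ofReal (ε * (|a| + |b|)) * volume (E j) ≤
        volume ((fun t => f (polarPt (r j) t)) '' E j) := by
      intro j
      have hder : ∀ t ∈ E j, HasDerivWithinAt (fun t => f (polarPt (r j) t))
          (r j * (b * Real.cos t - a * Real.sin t)) (E j) t := by
        intro t _
        apply HasDerivAt.hasDerivWithinAt
        have h1 := (((Real.hasDerivAt_cos t).const_mul (r j)).const_mul a).add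
          (((Real.hasDerivAt_sin t).const_mul (r j)).const_mul b) |>.add_const c
        have h3 : a * (r j * -Real.sin t) + b * (r j * Real.cos t) =
            r j * (b * Real.cos t - a * Real.sin t) := by ring
        rw [h3] at h1
        exact h1
      have h2 := lintegral_image_eq_lintegral_abs_deriv_mul (hEm j) hder (hEi j) (fun _ => 1)
      simp only [mul_one, lintegral_one, Measure.restrict_apply_univ] at h2
      rw [h2, ← setLIntegral_const]
      refine setLIntegral_mono' (hEm j) fun t ht => ENNReal.ofReal_le_ofReal ?_
      have hnb : ¬ |b * Real.cos t - a * Real.sin t| < ε * (|a| + |b|) := fun hlt =>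
        (Set.disjoint_left.1 hGb ht.2) ⟨hG1 ht.2, hlt⟩
      rw [abs_mul, abs_of_pos (hr0 j)]
      nlinarith [hr1 j, abs_nonneg (b * Real.cos t - a * Real.sin t)]
    have hsum : ∑ j, volume ((fun t => f (polarPt (r j) t)) '' E j) ≤
        ENNReal.ofReal (4 * (|a| + |b|)) := by
      have hdis : Pairwise (Function.onFun Disjoint
          fun j => ((fun t => f (polarPt (r j) t)) '' E j)) := by
        intro j k hjk
        refine Set.disjoint_left.2 ?_
        rintro _ ⟨t, ht, rfl⟩ ⟨u, hu, h⟩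
        exact hjk (hcr j k t ht u hu h.symm).1
      rw [← tsum_fintype (L := .unconditional _), ← measure_iUnion hdis himm]
      have hsub : (⋃ j, (fun t => f (polarPt (r j) t)) '' E j) ⊆
          Icc (c - 2 * (|a| + |b|)) (c + 2 * (|a| + |b|)) := by
        refine iUnion_subset fun j => ?_
        rintro _ ⟨t, _, rfl⟩
        have h1 : |a * (r j * Real.cos t) + b * (r j * Real.sin t)| ≤ 2 * (|a| + |b|) := by
          calc _ ≤ |a * (r j * Real.cos t)| + |b * (r j * Real.sin t)| := abs_add_le _ _
            _ = |a| * (r j * |Real.cos t|) + |b| * (r j * |Real.sin t|) := by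
              simp only [abs_mul, abs_of_pos (hr0 j)]
            _ ≤ |a| * (2 * 1) + |b| * (2 * 1) := by
              gcongr
              · exact hr2 j
              · exact Real.abs_cos_le_one t
              · exact hr2 j
              · exact Real.abs_sin_le_one t
            _ = _ := by ring
        have := abs_le.1 h1
        simp only [hf, polarPt, Matrix.cons_val_zero, Matrix.cons_val_one]
        constructor <;> linarith
      refine (measure_mono hsub).trans ?_
      rw [Real.volume_Icc]
      apply ENNReal.ofReal_le_ofReal
      linarith
    have hfin : ENNReal.ofReal (ε * (|a| + |b|)) * ∑ j, volume (E j) ≤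
        ENNReal.ofReal (ε * (|a| + |b|)) * ENNReal.ofReal (4 / ε) := by
      rw [Finset.mul_sum, ← ENNReal.ofReal_mul (by positivity)]
      refine (Finset.sum_le_sum fun j _ => hlow j).trans (hsum.trans ?_)
      apply ENNReal.ofReal_le_ofReal
      apply le_of_eq
      field_simp
    have hne : ENNReal.ofReal (ε * (|a| + |b|)) ≠ 0 := by
      simpa using mul_pos hε hρ
    exact (ENNReal.mul_le_mul_iff_right hne ENNReal.ofReal_ne_top).1 hfin

lemma atlas_bound {n k B : ℕ} (hk : k ≤ B) (r : Fin n → ℝ) (hr : Function.Injective r)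
    (hr1 : ∀ j, 1 ≤ r j) (hr2 : ∀ j, r j ≤ 2)
    (h : LinRectAtlas 1 (circlesOf (range fun j => r j ^ 2)) k) : n ≤ 128 * (B + 1) ^ 2 := by
  obtain ⟨U, A, hcov, hemb⟩ := h
  set C := circlesOf (range fun j => r j ^ 2)
  have hB : (0 : ℝ) < (B : ℝ) + 1 := by positivity
  set ε : ℝ := 1 / (16 * ((B : ℝ) + 1)) with hεd
  have hε : 0 < ε := by positivity
  have hA : ∀ i, ∃ a b c : ℝ, ∀ x, A i x 0 = a * x 0 + b * x 1 + c := fun i => affine_coord _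
  choose a b c habc using hA
  have hD : ∀ i, ∃ D', U i ∩ C ⊆ D' ∧ MeasurableSet D' ∧ InjOn (A i) D' := fun i =>
    chart_borel (A i) (AffineMap.continuous_of_finiteDimensional _) _ (hemb i)
  choose D hDs hDm hDi using hD
  set G : Set ℝ := Icc 0 1 \ ⋃ i, badSet (a i) (b i) ε with hG
  have hGm : MeasurableSet G :=
    measurableSet_Icc.diff (MeasurableSet.iUnion fun i => badSet_meas _ _ _)
  have hch : ∀ i, ∑ j, volume (polarPt (r j) ⁻¹' D i ∩ G) ≤ ENNReal.ofReal (4 / ε) := by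
    intro i
    refine chart_bound r hr hr1 hr2 (a i) (b i) (c i) ε hε (D i) (hDm i) ?_ G hGm sdiff_subset ?_
    · intro x hx y hy hxy
      apply hDi i hx hy
      funext z
      have hz : z = 0 := Subsingleton.elim _ _
      subst hz
      rw [habc, habc]
      exact hxy
    · exact disjoint_sdiff_left.mono_right (subset_iUnion (fun i => badSet (a i) (b i) ε) i)
  have hkB : (k : ℝ) ≤ B + 1 := by
    have : (k : ℝ) ≤ B := by exact_mod_cast hk
    linarith
  have hbad : volume (⋃ i, badSet (a i) (b i) ε) ≤ ENNReal.ofReal (1 / 2) := by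
    calc volume (⋃ i, badSet (a i) (b i) ε) ≤ ∑ i, volume (badSet (a i) (b i) ε) :=
          measure_iUnion_fintype_le _ _
      _ ≤ ∑ _i : Fin k, ENNReal.ofReal (8 * ε) :=
          Finset.sum_le_sum fun i _ => badSet_vol _ _ _ hε.le
      _ = ENNReal.ofReal (k * (8 * ε)) := by
          rw [Finset.sum_const, Finset.card_univ, Fintype.card_fin, nsmul_eq_mul,
            ENNReal.ofReal_mul (p := (k : ℝ)) (Nat.cast_nonneg _), ENNReal.ofReal_natCast]
      _ ≤ _ := by
          apply ENNReal.ofReal_le_ofReal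
          calc (k : ℝ) * (8 * ε) ≤ (B + 1) * (8 * ε) := by gcongr
            _ = 1 / 2 := by rw [hεd]; field_simp; norm_num
  have hGv : ENNReal.ofReal (1 / 2) ≤ volume G := by
    have h1 : volume (Icc (0 : ℝ) 1) ≤ volume G + volume (⋃ i, badSet (a i) (b i) ε) := by
      refine (measure_mono ?_).trans (measure_union_le _ _)
      rw [hG, sdiff_union_self]
      exact subset_union_left
    have h2 := h1.trans (add_le_add_right hbad (volume G))
    rw [Real.volume_Icc, show (1 : ℝ) - 0 = 1 / 2 + 1 / 2 by norm_num,
      ENNReal.ofReal_add (by norm_num) (by norm_num)] at h2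
    exact (ENNReal.add_le_add_iff_right ENNReal.ofReal_ne_top).1 h2
  have hGj : ∀ j, volume G ≤ ∑ i, volume (polarPt (r j) ⁻¹' D i ∩ G) := by
    intro j
    refine (measure_mono ?_).trans (measure_iUnion_fintype_le _ _)
    intro t ht
    have hC : polarPt (r j) t ∈ C := by
      change _ ∈ range _
      exact ⟨j, (polarPt_sq _ _).symm⟩
    obtain ⟨i, hi⟩ := mem_iUnion.1 (hcov hC)
    exact mem_iUnion.2 ⟨i, hDs i ⟨hi, hC⟩, ht⟩
  have hfin : ENNReal.ofReal (n * (1 / 2)) ≤ ENNReal.ofReal (k * (4 / ε)) := by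
    calc ENNReal.ofReal (n * (1 / 2)) = ∑ _j : Fin n, ENNReal.ofReal (1 / 2) := by
          rw [Finset.sum_const, Finset.card_univ, Fintype.card_fin, nsmul_eq_mul,
            ENNReal.ofReal_mul (Nat.cast_nonneg _), ENNReal.ofReal_natCast]
      _ ≤ ∑ j, ∑ i, volume (polarPt (r j) ⁻¹' D i ∩ G) :=
          Finset.sum_le_sum fun j _ => hGv.trans (hGj j)
      _ = ∑ i, ∑ j, volume (polarPt (r j) ⁻¹' D i ∩ G) := Finset.sum_comm
      _ ≤ ∑ _i : Fin k, ENNReal.ofReal (4 / ε) := Finset.sum_le_sum fun i _ => hch i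
      _ = _ := by
          rw [Finset.sum_const, Finset.card_univ, Fintype.card_fin, nsmul_eq_mul,
            ENNReal.ofReal_mul (Nat.cast_nonneg _), ENNReal.ofReal_natCast]
  rw [ENNReal.ofReal_le_ofReal_iff (by positivity)] at hfin
  have h4 : 4 / ε = 64 * ((B : ℝ) + 1) := by rw [hεd]; field_simp; norm_num
  rw [h4] at hfin
  have : (n : ℝ) ≤ 128 * ((B : ℝ) + 1) ^ 2 := by nlinarith
  exact_mod_cast this

lemma part_one (B : ℕ) : ∃ C : Set (Fin 2 → ℝ), IsCompact C ∧ IsEmbeddedManifold 1 C ∧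
      B < sInf {k | LinRectAtlas 1 C k} := by
  set n : ℕ := 128 * (B + 1) ^ 2 + 1 with hn
  have hn0 : (0 : ℝ) < n := by rw [hn]; positivity
  let r : Fin n → ℝ := fun j => 1 + (j : ℝ) / n
  have hr1 : ∀ j, 1 ≤ r j := fun j => by
    have : 0 ≤ (j : ℝ) / n := by positivity
    simp only [r]; linarith
  have hr2 : ∀ j, r j ≤ 2 := fun j => by
    have : (j : ℝ) / n ≤ 1 := by
      rw [div_le_one hn0]
      exact_mod_cast j.2.le
    simp only [r]; linarith
  have hr : Function.Injective r := by
    intro i j hij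
    have h1 : (i : ℝ) / n = (j : ℝ) / n := by simpa [r] using hij
    rw [div_left_inj' hn0.ne'] at h1
    exact Fin.ext (by exact_mod_cast h1)
  have hS : (range fun j => r j ^ 2).Finite := finite_range _
  have hpos : ∀ s ∈ range fun j => r j ^ 2, 0 < s := by
    rintro _ ⟨j, rfl⟩
    have := hr1 j
    simp only
    positivity
  refine ⟨circlesOf (range fun j => r j ^ 2), circles_compact hS, circles_manifold hS hpos, ?_⟩
  by_contra hcon
  have hmem := Nat.sInf_mem (s := {k | LinRectAtlas 1 (circlesOf (range fun j => r j ^ 2)) k})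
    (circles_atlas hS hpos)
  have := atlas_bound (not_lt.1 hcon) r hr hr1 hr2 hmem
  omega

lemma part_two (n m : ℕ) (hn : n = 2) (hm : m = 1) :
    ∃ C : Set (Fin n → ℝ), IsCompact C ∧ IsEmbeddedManifold 1 C ∧
      ∀ f : (Fin n → ℝ) → (Fin m → ℝ), Continuous f → ¬ InjOn f C := by
  subst hn hm
  refine ⟨circlesOf {1}, circles_compact (finite_singleton 1),
    circles_manifold (finite_singleton 1) (by simp), fun f hf hinj => ?_⟩
  let h : ℝ → ℝ := fun t => f (polarPt 1 (t + Real.pi)) 0 - f (polarPt 1 t) 0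
  have hp := polarPt_continuous 1
  have hc : Continuous h := by
    have h1 : Continuous fun t => f (polarPt 1 (t + Real.pi)) 0 :=
      (continuous_apply 0).comp (hf.comp (hp.comp (by fun_prop)))
    have h2 : Continuous fun t => f (polarPt 1 t) 0 := (continuous_apply 0).comp (hf.comp hp)
    exact h1.sub h2
  have hper : polarPt 1 (Real.pi + Real.pi) = polarPt 1 0 := by
    rw [← two_mul]; simp [polarPt]
  have hanti : h Real.pi = - h 0 := by simp [h, hper]
  have hz : ∃ t, h t = 0 := by
    rcases le_total (h 0) 0 with h0 | h0
    · exact mem_range_of_exists_le_of_exists_ge hc ⟨0, h0⟩ ⟨Real.pi, by linarith⟩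
    · exact mem_range_of_exists_le_of_exists_ge hc ⟨Real.pi, by linarith⟩ ⟨0, h0⟩
  obtain ⟨t, ht⟩ := hz
  have hmem : ∀ t, polarPt 1 t ∈ circlesOf {1} := fun t => by
    change _ ∈ ({1} : Set ℝ)
    rw [polarPt_sq]; simp
  have heq : f (polarPt 1 (t + Real.pi)) = f (polarPt 1 t) := by
    funext z
    have hz : z = 0 := Subsingleton.elim _ _
    subst hz
    exact sub_eq_zero.1 ht
  have h2 := hinj (hmem _) (hmem _) heq
  have hc' := congrFun h2 0
  have hs' := congrFun h2 1
  simp [polarPt, Real.cos_add_pi, Real.sin_add_pi] at hc' hs'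
  have := Real.sin_sq_add_cos_sq t
  have h3 : Real.cos t = 0 := by linarith
  have h4 : Real.sin t = 0 := by linarith
  rw [h3, h4] at this
  norm_num at this

lemma hiddenEval_continuous (w : ℕ → ℕ)
    (T : ∀ i : ℕ, (Fin (w i) → ℝ) →ᵃ[ℝ] (Fin (w (i + 1)) → ℝ)) (j : ℕ) :
    Continuous (hiddenEval w T j) := by
  induction j with
  | zero => exact continuous_id
  | succ j ih =>
    have h1 : Continuous fun x => T j (hiddenEval w T j x) :=
      (AffineMap.continuous_of_finiteDimensional (T j)).comp ih
    refine continuous_pi fun i => ?_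
    exact continuous_const.max ((continuous_apply i).comp h1)

/-- (1) For every bound `B` there is a compact embedded curve (1-manifold) `C ⊆ ℝ²` whose
rectified linear complexity exceeds `B`.  (2) Hence for any ReLU DNN architecture with
input dimension `2` and output dimension `1`, there exists an embedded compact curve on
which no function realized by that architecture is injective, i.e. the curve admits no
encoding map realized by the architecture. -/
theorem stmt_14 :
    (∀ B : ℕ, ∃ C : Set (Fin 2 → ℝ), IsCompact C ∧ IsEmbeddedManifold 1 C ∧
      B < sInf {k | LinRectAtlas 1 C k}) ∧
    ∀ (kk : ℕ) (w : ℕ → ℕ), w 0 = 2 → w (kk + 1) = 1 →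
      ∃ C : Set (Fin (w 0) → ℝ), IsCompact C ∧ IsEmbeddedManifold 1 C ∧
        ∀ T : (∀ i : ℕ, (Fin (w i) → ℝ) →ᵃ[ℝ] (Fin (w (i + 1)) → ℝ)),
          ¬ Set.InjOn (fun x => T kk (hiddenEval w T kk x)) C := by
  refine ⟨part_one, fun kk w h0 h1 => ?_⟩
  obtain ⟨C, hC, hM, hf⟩ := part_two (w 0) (w (kk + 1)) h0 h1
  exact ⟨C, hC, hM, fun T => hf _
    ((AffineMap.continuous_of_finiteDimensional (T kk)).comp (hiddenEval_continuous w T kk))⟩
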